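/- Let V be a real inner product space, Q a real vector space, a : V × V → ℝ and b : V × Q → ℝ bilinear maps, and α > 0. Let ȳ, ỹ, z̄, z̃, z̄_h ∈ V and p̄, p̃, r̄, r̃ ∈ Q, and define the controls ū := −(1/α) z̄ and ũ := −(1/α) z̄_h. Suppose the error system holds: a(ȳ−ỹ, v) − b(v, p̄−p̃) = ⟨ū−ũ, v⟩ for all v ∈ V; b(ȳ−ỹ, φ) = 0 for all φ ∈ Q; a(w, z̄−z̃) + b(w, r̄−r̃) = ⟨ȳ−ỹ, w⟩ for all w ∈ V; b(z̄−z̃, ψ) = 0 for all ψ ∈ Q. Then α ‖ū − ũ‖ ≤ ‖z̃ − z̄_h‖. -/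

import Mathlib

open RealInnerProductSpace

/-- The central estimate `α ‖ū − ũ‖ ≤ ‖z̃ − z̄_h‖` in part (i) of the proof of the
global reliability theorem for the pressure-robust a posteriori error estimator. -/
theorem stmt_2
    {V : Type*} [NormedAddCommGroup V] [InnerProductSpace ℝ V]
    {Q : Type*} [AddCommGroup Q] [Module ℝ Q]
    (a : V →ₗ[ℝ] V →ₗ[ℝ] ℝ) (b : V →ₗ[ℝ] Q →ₗ[ℝ] ℝ)
    (α : ℝ) (hα : 0 < α)
    (ybar ytil zbar ztil zbarh : V) (pbar ptil rbar rtil : Q)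
    (ubar util : V)
    (hubar : ubar = -(1 / α) • zbar)
    (hutil : util = -(1 / α) • zbarh)
    (h1 : ∀ v : V, a (ybar - ytil) v - b v (pbar - ptil) = ⟪ubar - util, v⟫)
    (h2 : ∀ φ : Q, b (ybar - ytil) φ = 0)
    (h3 : ∀ w : V, a w (zbar - ztil) + b w (rbar - rtil) = ⟪ybar - ytil, w⟫)
    (h4 : ∀ ψ : Q, b (zbar - ztil) ψ = 0) :
    α * ‖ubar - util‖ ≤ ‖ztil - zbarh‖ := by
  have duality : ⟪ubar - util, zbar - ztil⟫ = ⟪ybar - ytil, ybar - ytil⟫ := by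
    have hz := h1 (zbar - ztil)
    have hy := h3 (ybar - ytil)
    rw [h4, sub_zero] at hz
    rw [h2, add_zero] at hy
    exact hz.symm.trans hy
  have control : α • (ubar - util) = -(zbar - ztil) - (ztil - zbarh) := by
    rw [hubar, hutil, ← smul_sub, smul_smul, mul_neg, mul_one_div_cancel hα.ne', neg_one_smul]
    abel
  have key : α * ‖ubar - util‖ * ‖ubar - util‖ ≤ ‖ztil - zbarh‖ * ‖ubar - util‖ :=
    calc α * ‖ubar - util‖ * ‖ubar - util‖ = ⟪ubar - util, α • (ubar - util)⟫ := by
          rw [real_inner_smul_right, real_inner_self_eq_norm_mul_norm, mul_assoc]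
      _ = -⟪ybar - ytil, ybar - ytil⟫ - ⟪ubar - util, ztil - zbarh⟫ := by
          rw [control, inner_sub_right, inner_neg_right, duality]
      _ ≤ ‖ztil - zbarh‖ * ‖ubar - util‖ := by
          have hcs := abs_real_inner_le_norm (ubar - util) (ztil - zbarh)
          have hnonneg := real_inner_self_nonneg (x := ybar - ytil)
          linarith [neg_abs_le ⟪ubar - util, ztil - zbarh⟫]
  rcases (norm_nonneg (ubar - util)).eq_or_lt with h | h
  · rw [← h, mul_zero]
    exact norm_nonneg _
  · exact le_of_mul_le_mul_right key h
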